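/- Let K be a convex body in ℝⁿ whose centroid is at the origin. Then vol(K) ≤ ((n+1)ⁿ / n!) · ∏_{i=1}^{n} λᵢ(K*), where λᵢ denote the successive minima with respect to the lattice ℤⁿ. -/

import Mathlib

open MeasureTheory
open scoped RealInnerProductSpace Pointwise

noncomputable section

/-- Euclidean `n`-space. -/
abbrev E (n : ℕ) := EuclideanSpace ℝ (Fin n)

/-- A convex body: a compact convex set with nonempty interior. -/
def IsConvexBody {n : ℕ} (K : Set (E n)) : Prop :=
  Convex ℝ K ∧ IsCompact K ∧ (interior K).Nonempty

/-- Central symmetral `cs K = (1/2)(K - K)`. -/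
def csBody {n : ℕ} (K : Set (E n)) : Set (E n) := (2⁻¹ : ℝ) • (K - K)

/-- Polar body `L* = {y : ⟨x, y⟩ ≤ 1 for all x ∈ L}`. -/
def polarBody {n : ℕ} (L : Set (E n)) : Set (E n) :=
  {y | ∀ x ∈ L, ⟪x, y⟫ ≤ 1}

/-- A point of the integer lattice `ℤⁿ ⊆ ℝⁿ`. -/
def isLatticePoint {n : ℕ} (z : E n) : Prop := ∀ j, ∃ m : ℤ, z j = (m : ℝ)

/-- The `i`-th successive minimum of `L` with respect to the lattice `ℤⁿ`:
the least `λ > 0` such that `λ • L` contains `i` linearly independent lattice points. -/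
def succMin {n : ℕ} (L : Set (E n)) (i : ℕ) : ℝ :=
  sInf {lam : ℝ | 0 < lam ∧ ∃ v : Fin i → E n,
    LinearIndependent ℝ v ∧ ∀ j, isLatticePoint (v j) ∧ v j ∈ lam • L}

lemma lintegral_Ici_ofReal_max_sub_pow (m : ℕ) (t : ℝ) :
    ∫⁻ a in Set.Ici (0 : ℝ), ENNReal.ofReal (max (t - a) 0 ^ (m + 1)) =
      ENNReal.ofReal (max t 0 ^ (m + 2) / (m + 2)) := by
  have hsupp : ∫⁻ a in Set.Ici (0 : ℝ), ENNReal.ofReal (max (t - a) 0 ^ (m + 1)) =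
      ∫⁻ a in Set.Ioc 0 (max t 0), ENNReal.ofReal ((max t 0 - a) ^ (m + 1)) := by
    rw [setLIntegral_congr Ioi_ae_eq_Ici.symm, ← lintegral_indicator measurableSet_Ioi,
      ← lintegral_indicator measurableSet_Ioc]
    congr 1 with a
    by_cases ha : 0 < a
    · by_cases hat : a ≤ max t 0
      · have ht : 0 < t := by
          by_contra! h
          rw [max_eq_right h] at hat
          linarith
        rw [max_eq_left ht.le] at hat
        simp [Set.indicator, ha, hat, ht.le]
      · have : t - a ≤ 0 := by linarith [not_le.1 hat, le_max_left t 0]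
        simp [Set.indicator, hat, max_eq_right this]
    · simp [Set.indicator, ha]
  rw [hsupp, ← ofReal_integral_eq_lintegral_ofReal]
  · congr 1
    rw [← intervalIntegral.integral_of_le (le_max_right t 0),
      intervalIntegral.integral_comp_sub_left (fun a => a ^ (m + 1)), integral_pow]
    push_cast
    simp
    ring
  · exact (Continuous.integrableOn_Icc (by fun_prop)).mono_set Set.Ioc_subset_Icc_self
  · filter_upwards [ae_restrict_mem measurableSet_Ioc] with a ha
    exact pow_nonneg (sub_nonneg.2 ha.2) _

lemma measurable_indicator_Ici_ofReal_sub_sum (n : ℕ) (t : ℝ) :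
    Measurable ((Set.Ici (0 : Fin n → ℝ)).indicator
      fun z => ENNReal.ofReal (t - ∑ i, z i)) :=
  Measurable.indicator (by fun_prop) measurableSet_Ici

/-- The integral of `(t - ∑ zᵢ)⁺` over the nonnegative orthant of `ℝⁿ`. -/
lemma lintegral_indicator_Ici_ofReal_sub_sum (n : ℕ) (t : ℝ) :
    ∫⁻ z : Fin n → ℝ, (Set.Ici 0).indicator (fun z => ENNReal.ofReal (t - ∑ i, z i)) z =
      ENNReal.ofReal (max t 0 ^ (n + 1) / (n + 1).factorial) := by
  induction n generalizing t with
  | zero =>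
    rw [lintegral_unique, volume_pi, Measure.pi_univ]
    simp [Set.indicator]
  | succ n ih =>
    have hmp := (volume_preserving_piFinSuccAbove (fun _ : Fin (n + 1) => ℝ) 0).symm
    rw [← hmp.lintegral_comp (measurable_indicator_Ici_ofReal_sub_sum _ _),
      Measure.volume_eq_prod, lintegral_prod]
    swap
    · exact ((measurable_indicator_Ici_ofReal_sub_sum _ _).comp hmp.measurable).aemeasurable
    have hfib (a : ℝ) :
        ∫⁻ y : Fin n → ℝ, (Set.Ici 0).indicator (fun z => ENNReal.ofReal (t - ∑ i, z i))
          ((MeasurableEquiv.piFinSuccAbove (fun _ : Fin (n + 1) => ℝ) 0).symm (a, y)) =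
        (Set.Ici 0).indicator (fun a => ENNReal.ofReal (((n + 1).factorial : ℝ)⁻¹) *
          ENNReal.ofReal (max (t - a) 0 ^ (n + 1))) a := by
      have hcons (y : Fin n → ℝ) :
          (Set.Ici 0).indicator (fun z => ENNReal.ofReal (t - ∑ i, z i))
            ((MeasurableEquiv.piFinSuccAbove (fun _ : Fin (n + 1) => ℝ) 0).symm (a, y)) =
          (Set.Ici 0).indicator (fun a => (Set.Ici 0).indicator
            (fun y => ENNReal.ofReal (t - a - ∑ i, y i)) y) a := by
        simp [Set.indicator, MeasurableEquiv.piFinSuccAbove, Fin.insertNthEquiv, Fin.sum_univ_succ,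
          Pi.le_def, Fin.forall_fin_succ, sub_sub, ite_and]
      simp_rw [hcons]
      by_cases ha : a ∈ Set.Ici (0 : ℝ)
      · simp only [Set.indicator_of_mem ha, ih]
        rw [← ENNReal.ofReal_mul (by positivity), div_eq_inv_mul]
      · simp [Set.indicator_of_notMem ha]
    simp_rw [hfib]
    rw [lintegral_indicator measurableSet_Ici, lintegral_const_mul' _ _ ENNReal.ofReal_ne_top,
      lintegral_Ici_ofReal_max_sub_pow, ← ENNReal.ofReal_mul (by positivity)]
    congr 1
    rw [Nat.factorial_succ (n + 1)]
    push_cast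
    field_simp
    ring

/-- Nonnegative affine coordinates `1 - M x` on a set with centroid at the origin bound its
volume. -/
lemma volume_toReal_le_of_mulVec_le_one {n : ℕ} {K : Set (E n)} (hK : IsCompact K)
    (hcentroid : ∫ x in K, x ∂volume = 0) (M : Matrix (Fin n) (Fin n) ℝ) (hM : M.det ≠ 0)
    (hKM : ∀ x ∈ K, ∀ i, M.mulVec x.ofLp i ≤ 1) :
    (volume K).toReal ≤ |M.det|⁻¹ * ((n + 1 : ℝ) ^ n / n.factorial) := by
  have hid : IntegrableOn (fun x : E n => x) K := continuous_id.continuousOn.integrableOn_compact hK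
  set L : E n → ℝ := fun x => ∑ i, M.mulVec x.ofLp i with hL
  have hLw : ∀ x, L x = ⟪WithLp.toLp 2 (fun j => ∑ i, M i j), x⟫ := by
    intro x
    simp only [hL, Matrix.mulVec, dotProduct, PiLp.inner_apply]
    rw [Finset.sum_comm]
    simp [Finset.mul_sum, mul_comm]
  have hLi : IntegrableOn L K := by
    simp_rw [funext hLw]
    exact hid.const_inner _
  have hint : ∫ x in K, (1 + L x) = (volume K).toReal := by
    have h1 : IntegrableOn (fun _ : E n => (1 : ℝ)) K :=
      integrableOn_const hK.measure_lt_top.ne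
    rw [integral_add h1 hLi]
    simp_rw [hLw]
    rw [integral_inner hid, hcentroid]
    simp [measureReal_def]
  set F : (Fin n → ℝ) → ENNReal :=
    (Set.Ici 0).indicator fun z => ENNReal.ofReal ((n + 1 : ℝ) - ∑ i, z i) with hF
  have hFm : Measurable F := measurable_indicator_Ici_ofReal_sub_sum _ _
  have hcov : ∫⁻ x : E n, F (1 - Matrix.toLin' M x.ofLp) =
      ENNReal.ofReal (|M.det|⁻¹ * ((n + 1 : ℝ) ^ n / n.factorial)) := by
    have hM' : Measurable (Matrix.toLin' M) :=
      (Matrix.toLin' M).continuous_of_finiteDimensional.measurable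
    rw [(PiLp.volume_preserving_ofLp (Fin n)).lintegral_comp
        (f := fun y => F (1 - Matrix.toLin' M y)) (hFm.comp (hM'.const_sub 1)),
      ← lintegral_map (f := fun y => F (1 - y)) (hFm.comp (measurable_id.const_sub 1)) hM',
      Real.map_matrix_volume_pi_eq_smul_volume_pi hM, lintegral_smul_measure,
      lintegral_sub_left_eq_self F, hF, lintegral_indicator_Ici_ofReal_sub_sum, smul_eq_mul,
      ← ENNReal.ofReal_mul (abs_nonneg _), abs_inv, max_eq_left (by positivity)]
    congr 2
    rw [Nat.factorial_succ]
    push_cast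
    field_simp
    ring
  have hle : ∫⁻ x in K, ENNReal.ofReal (1 + L x) ≤
      ENNReal.ofReal (|M.det|⁻¹ * ((n + 1 : ℝ) ^ n / n.factorial)) := by
    rw [← hcov]
    refine (setLIntegral_mono' hK.measurableSet fun x hx => ?_).trans
      (setLIntegral_le_lintegral K _)
    have hmem : (1 - Matrix.toLin' M x.ofLp) ∈ Set.Ici (0 : Fin n → ℝ) := by
      intro i
      simpa using hKM x hx i
    rw [hF, Set.indicator_of_mem hmem]
    refine ENNReal.ofReal_le_ofReal (le_of_eq ?_)
    simp [hL, Finset.sum_sub_distrib]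
  rw [← hint, integral_eq_lintegral_pos_part_sub_lintegral_neg_part
    (f := fun x => 1 + L x) (Integrable.add (integrableOn_const hK.measure_lt_top.ne) hLi)]
  refine (sub_le_self _ ENNReal.toReal_nonneg).trans ?_
  exact ENNReal.toReal_le_of_le_ofReal (by positivity) hle

/-- A transversal of linearly independent families of increasing size can be chosen to be
linearly independent. -/
lemma exists_linearIndependent_of_forall_exists {V : Type*} [AddCommGroup V] [Module ℝ V]
    (P : ℕ → V → Prop) (n : ℕ)
    (h : ∀ i < n, ∃ w : Fin (i + 1) → V, LinearIndependent ℝ w ∧ ∀ j, P i (w j)) :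
    ∃ v : Fin n → V, LinearIndependent ℝ v ∧ ∀ i : Fin n, P i (v i) := by
  induction n with
  | zero => exact ⟨Fin.elim0, linearIndependent_empty_type, fun i => i.elim0⟩
  | succ n ih =>
    obtain ⟨v, hv, hP⟩ := ih fun i hi => h i (hi.trans n.lt_succ_self)
    obtain ⟨w, hw, hPw⟩ := h n n.lt_succ_self
    have hex : ∃ j, w j ∉ Submodule.span ℝ (Set.range v) := by
      by_contra! hall
      have := FiniteDimensional.span_of_finite ℝ (Set.finite_range v)
      have := Submodule.finrank_mono (Submodule.span_le.2 (Set.range_subset_iff.2 hall))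
      rw [finrank_span_eq_card hw, finrank_span_eq_card hv] at this
      simp at this
    obtain ⟨j, hj⟩ := hex
    refine ⟨Fin.snoc v (w j), linearIndependent_finSnoc.2 ⟨hv, hj⟩, fun i => ?_⟩
    induction i using Fin.lastCases with
    | last => simpa using hPw j
    | cast i => simpa using hP i

lemma one_le_abs_det_of_isLatticePoint {n : ℕ} {v : Fin n → E n} (hv : LinearIndependent ℝ v)
    (hlat : ∀ i, isLatticePoint (v i)) : 1 ≤ |(Matrix.of fun i => (v i).ofLp).det| := by
  choose m hm using hlat
  have hli : LinearIndependent ℝ (Matrix.of fun i => (v i).ofLp).row :=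
    hv.map' (WithLp.linearEquiv 2 ℝ (Fin n → ℝ)).toLinearMap (LinearEquiv.ker _)
  have hdet : (Matrix.of fun i => (v i).ofLp).det = ((Matrix.of m).det : ℝ) := by
    rw [Int.cast_det]
    congr 1
    ext i j
    simp [hm]
  have hne := ((Matrix.isUnit_iff_isUnit_det _).1
    (Matrix.linearIndependent_rows_iff_isUnit.1 hli)).ne_zero
  rw [hdet] at hne ⊢
  exact_mod_cast Int.one_le_abs (by exact_mod_cast hne)

/-- The scaling factors whose infimum is the successive minimum of the polar of a bounded set
do exist. -/
lemma exists_smul_polarBody_linearIndependent {n : ℕ} {K : Set (E n)}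
    (hK : Bornology.IsBounded K) {i : ℕ} (hi : i ≤ n) :
    {lam : ℝ | 0 < lam ∧ ∃ v : Fin i → E n, LinearIndependent ℝ v ∧
      ∀ j, isLatticePoint (v j) ∧ v j ∈ lam • polarBody K}.Nonempty := by
  obtain ⟨R, hR, hKR⟩ := hK.exists_pos_norm_le
  refine ⟨R, hR, fun j => EuclideanSpace.basisFun (Fin n) ℝ (Fin.castLE hi j), ?_,
    fun j => ⟨?_, ?_⟩⟩
  · exact (EuclideanSpace.basisFun (Fin n) ℝ).orthonormal.linearIndependent.comp _
      (Fin.castLE_injective hi)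
  · intro k
    by_cases h : k = Fin.castLE hi j
    · exact ⟨1, by simp [h]⟩
    · exact ⟨0, by simp [h]⟩
  · rw [Set.mem_smul_set_iff_inv_smul_mem₀ hR.ne']
    intro x hx
    rw [inner_smul_right, inv_mul_le_iff₀ hR, mul_one]
    calc _ ≤ ‖x‖ * ‖EuclideanSpace.basisFun (Fin n) ℝ (Fin.castLE hi j)‖ := real_inner_le_norm _ _
      _ ≤ R := by simpa using hKR x hx


theorem upper_bound_centroid (n : ℕ) (K : Set (E n)) (hK : IsConvexBody K)
    (hcentroid : ∫ x in K, x ∂volume = 0) :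
    (volume K).toReal ≤ ((n + 1 : ℝ) ^ n / (Nat.factorial n : ℝ)) *
      ∏ i ∈ Finset.Icc 1 n, succMin (polarBody K) i := by
  obtain ⟨-, hcpt, -⟩ := hK
  have key : ∀ ε > 0, (volume K).toReal ≤ ((n + 1 : ℝ) ^ n / (Nat.factorial n : ℝ)) *
      ∏ i ∈ Finset.Icc 1 n, (succMin (polarBody K) i + ε) := by
    intro ε hε
    have hmin : ∀ i < n, ∃ w : Fin (i + 1) → E n, LinearIndependent ℝ w ∧
        ∀ j, isLatticePoint (w j) ∧ ∃ μ, 0 < μ ∧ μ ≤ succMin (polarBody K) (i + 1) + ε ∧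
          ∀ x ∈ K, ⟪x, w j⟫ ≤ μ := by
      intro i hi
      obtain ⟨μ, ⟨hμ, w, hw, hwμ⟩, hlt⟩ := Real.lt_sInf_add_pos
        (exists_smul_polarBody_linearIndependent hcpt.isBounded hi) hε
      refine ⟨w, hw, fun j => ⟨(hwμ j).1, μ, hμ, hlt.le, fun x hx => ?_⟩⟩
      obtain ⟨y, hy, hyw⟩ := (hwμ j).2
      rw [← hyw]
      simpa [inner_smul_right] using mul_le_mul_of_nonneg_left (hy x hx) hμ.le
    obtain ⟨v, hv, hP⟩ := exists_linearIndependent_of_forall_exists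
      (fun i w => isLatticePoint w ∧ ∃ μ, 0 < μ ∧ μ ≤ succMin (polarBody K) (i + 1) + ε ∧
        ∀ x ∈ K, ⟪x, w⟫ ≤ μ) n hmin
    choose hlat μ hμ hle hKμ using hP
    have hdet := one_le_abs_det_of_isLatticePoint hv hlat
    set V : Matrix (Fin n) (Fin n) ℝ := Matrix.of fun i => (v i).ofLp with hV
    have hVM : (Matrix.of fun i j => (μ i)⁻¹ * V i j).det = (∏ i, μ i)⁻¹ * V.det := by
      rw [Matrix.det_mul_column, Finset.prod_inv_distrib]
    have hpos : 0 < ∏ i, μ i := Finset.prod_pos fun i _ => hμ i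
    have hVne : V.det ≠ 0 := by
      intro h
      norm_num [h] at hdet
    refine (volume_toReal_le_of_mulVec_le_one hcpt hcentroid
      (Matrix.of fun i j => (μ i)⁻¹ * V i j) ?_ fun x hx i => ?_).trans ?_
    · rw [hVM]
      exact mul_ne_zero (inv_ne_zero hpos.ne') hVne
    · have hmul : (Matrix.of fun i j => (μ i)⁻¹ * V i j).mulVec x.ofLp i = (μ i)⁻¹ * ⟪x, v i⟫ := by
        simp [Matrix.mulVec, dotProduct, PiLp.inner_apply, Finset.mul_sum, hV, mul_assoc]
      rw [hmul, inv_mul_le_iff₀ (hμ i), mul_one]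
      exact hKμ i x hx
    · rw [hVM, mul_comm]
      refine mul_le_mul_of_nonneg_left ?_ (by positivity)
      rw [abs_mul, abs_inv, abs_of_pos hpos, mul_inv, inv_inv]
      refine (mul_le_of_le_one_right hpos.le (inv_le_one_of_one_le₀ hdet)).trans ?_
      rw [← Finset.Ico_add_one_right_eq_Icc, Finset.prod_Ico_eq_prod_range, Nat.add_sub_cancel,
        ← Fin.prod_univ_eq_prod_range (fun i => succMin (polarBody K) (1 + i) + ε)]
      refine Finset.prod_le_prod (fun i _ => (hμ i).le) fun i _ => ?_
      rw [add_comm 1]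
      exact hle i
  have hcont : Continuous fun ε : ℝ => ((n + 1 : ℝ) ^ n / (Nat.factorial n : ℝ)) *
      ∏ i ∈ Finset.Icc 1 n, (succMin (polarBody K) i + ε) := by fun_prop
  have hlim := (hcont.tendsto 0).mono_left (nhdsWithin_le_nhds (s := Set.Ioi 0))
  simp only [add_zero] at hlim
  exact ge_of_tendsto hlim (Filter.eventually_of_mem self_mem_nhdsWithin key)
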